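/- arXiv:2501.14591 — 2 statements merged into one kernel-verified Lean document; each statement's English description precedes it below -/
import Mathlib

section
/- The metric average satisfies the quantitative metric property: for nonempty compact sets A, B ⊆ ℝ^d and any weight w ∈ [0,1], d_H(A ⊕_w B, A) ≤ w·d_H(A,B) and d_H(A ⊕_w B, B) ≤ (1−w)·d_H(A,B). -/
open Metric Set

/-- `Π(A,B) = {(a,b) ∈ A×B : ‖a−b‖ = dist(a,B) or ‖a−b‖ = dist(b,A)}`. -/
def metricPairs (d : ℕ) (A B : Set (EuclideanSpace ℝ (Fin d))) :
    Set (EuclideanSpace ℝ (Fin d) × EuclideanSpace ℝ (Fin d)) :=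
  {p | p.1 ∈ A ∧ p.2 ∈ B ∧
    (‖p.1 - p.2‖ = infDist p.1 B ∨ ‖p.1 - p.2‖ = infDist p.2 A)}

/-- The metric average `A ⊕_w B = {(1−w)a + w b : (a,b) ∈ Π(A,B)}`. -/
def metricAverage (d : ℕ) (A B : Set (EuclideanSpace ℝ (Fin d))) (w : ℝ) :
    Set (EuclideanSpace ℝ (Fin d)) :=
  (fun p : EuclideanSpace ℝ (Fin d) × EuclideanSpace ℝ (Fin d) =>
    (1 - w) • p.1 + w • p.2) '' metricPairs d A B

theorem norm_sub_le_hausdorffDist_of_mem_metricPairs {d : ℕ}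
    {A B : Set (EuclideanSpace ℝ (Fin d))} (hA : A.Nonempty) (hAc : IsCompact A)
    (hB : B.Nonempty) (hBc : IsCompact B)
    {p : EuclideanSpace ℝ (Fin d) × EuclideanSpace ℝ (Fin d)} (hp : p ∈ metricPairs d A B) :
    ‖p.1 - p.2‖ ≤ hausdorffDist A B := by
  have hfin := hausdorffEDist_ne_top_of_nonempty_of_bounded hA hB hAc.isBounded hBc.isBounded
  obtain ⟨h₁, h₂, h | h⟩ := hp
  · exact h.trans_le (infDist_le_hausdorffDist_of_mem h₁ hfin)
  · rw [hausdorffDist_comm]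
    rw [hausdorffEDist_comm] at hfin
    exact h.trans_le (infDist_le_hausdorffDist_of_mem h₂ hfin)

theorem exists_mem_metricPairs_of_mem_left {d : ℕ} {A B : Set (EuclideanSpace ℝ (Fin d))}
    (hB : B.Nonempty) (hBc : IsCompact B) {a : EuclideanSpace ℝ (Fin d)} (ha : a ∈ A) :
    ∃ b, (a, b) ∈ metricPairs d A B := by
  obtain ⟨b, hb, h⟩ := hBc.exists_infDist_eq_dist hB a
  exact ⟨b, ha, hb, Or.inl (by rw [h, dist_eq_norm])⟩

theorem exists_mem_metricPairs_of_mem_right {d : ℕ} {A B : Set (EuclideanSpace ℝ (Fin d))}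
    (hA : A.Nonempty) (hAc : IsCompact A) {b : EuclideanSpace ℝ (Fin d)} (hb : b ∈ B) :
    ∃ a, (a, b) ∈ metricPairs d A B := by
  obtain ⟨a, ha, h⟩ := hAc.exists_infDist_eq_dist hA b
  exact ⟨a, ha, hb, Or.inr (by rw [h, dist_comm, dist_eq_norm])⟩

theorem metricAverage_quantitative_metric_property
    (d : ℕ) (A B : Set (EuclideanSpace ℝ (Fin d)))
    (hA : A.Nonempty) (hAc : IsCompact A)
    (hB : B.Nonempty) (hBc : IsCompact B)
    (w : ℝ) (hw : w ∈ Icc (0 : ℝ) 1) :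
    hausdorffDist (metricAverage d A B w) A ≤ w * hausdorffDist A B ∧
      hausdorffDist (metricAverage d A B w) B ≤ (1 - w) * hausdorffDist A B := by
  obtain ⟨hw₀, hw₁⟩ := hw
  have hw₁' : 0 ≤ 1 - w := sub_nonneg.2 hw₁
  have left : ∀ p ∈ metricPairs d A B,
      dist ((1 - w) • p.1 + w • p.2) p.1 ≤ w * hausdorffDist A B := by
    intro p hp
    have e : (1 - w) • p.1 + w • p.2 - p.1 = (-w) • (p.1 - p.2) := by module
    rw [dist_eq_norm, e, norm_smul, norm_neg, Real.norm_of_nonneg hw₀]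
    gcongr
    exact norm_sub_le_hausdorffDist_of_mem_metricPairs hA hAc hB hBc hp
  have right : ∀ p ∈ metricPairs d A B,
      dist ((1 - w) • p.1 + w • p.2) p.2 ≤ (1 - w) * hausdorffDist A B := by
    intro p hp
    have e : (1 - w) • p.1 + w • p.2 - p.2 = (1 - w) • (p.1 - p.2) := by module
    rw [dist_eq_norm, e, norm_smul, Real.norm_of_nonneg hw₁']
    gcongr
    exact norm_sub_le_hausdorffDist_of_mem_metricPairs hA hAc hB hBc hp
  constructor
  · refine hausdorffDist_le_of_mem_dist (mul_nonneg hw₀ hausdorffDist_nonneg) ?_ ?_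
    · rintro _ ⟨p, hp, rfl⟩
      exact ⟨p.1, hp.1, left p hp⟩
    · intro a ha
      obtain ⟨b, hp⟩ := exists_mem_metricPairs_of_mem_left hB hBc ha
      exact ⟨_, mem_image_of_mem _ hp, by rw [dist_comm]; exact left _ hp⟩
  · refine hausdorffDist_le_of_mem_dist (mul_nonneg hw₁' hausdorffDist_nonneg) ?_ ?_
    · rintro _ ⟨p, hp, rfl⟩
      exact ⟨p.2, hp.2.1, right p hp⟩
    · intro b hb
      obtain ⟨a, hp⟩ := exists_mem_metricPairs_of_mem_right hA hAc hb
      exact ⟨_, mem_image_of_mem _ hp, by rw [dist_comm]; exact right _ hp⟩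
end

section
/- Let F : [0,1] → K(ℝ^d) be L-Lipschitz in the Hausdorff metric with all images F(t) contained in a fixed bounded set, let δ > 0 with J·δ = 1, and set τ_j = j·δ for j = 0,…,J. Suppose sets Ã_j ∈ K(ℝ^d), contained in a fixed bounded set, satisfy d_H(Ã_j, F(τ_j)) ≤ ε for all j. Define F̃(τ_j) = Ã_j and, for t ∈ (τ_j, τ_{j+1}), F̃(t) = Ã_j ⊕_w Ã_{j+1} with w = (t−τ_j)/δ. Then the graphs satisfy d_H(Graph(F̃), Graph(F)) ≤ 3ε + 2Lδ. -/
open Metric Set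

/-- The graph `{(t,y) : t ∈ [0,1], y ∈ F(t)}` of a set-valued function, as a subset of
`ℝ × ℝ^d` equipped with the Euclidean (L²) product metric. -/
def svGraph (d : ℕ) (F : ℝ → Set (EuclideanSpace ℝ (Fin d))) :
    Set (WithLp 2 (ℝ × EuclideanSpace ℝ (Fin d))) :=
  {p | (WithLp.equiv 2 (ℝ × EuclideanSpace ℝ (Fin d)) p).1 ∈ Icc (0 : ℝ) 1 ∧
    (WithLp.equiv 2 (ℝ × EuclideanSpace ℝ (Fin d)) p).2 ∈
      F (WithLp.equiv 2 (ℝ × EuclideanSpace ℝ (Fin d)) p).1}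

theorem exists_dist_eq_infDist_le {X : Type*} [MetricSpace X]
    {A B : Set X} {r : ℝ} (hA : A.Nonempty) (hAc : IsCompact A) (hB : B.Nonempty)
    (hBc : IsCompact B) (h : hausdorffDist A B ≤ r) {x : X} (hx : x ∈ A) :
    ∃ y ∈ B, dist x y = infDist x B ∧ dist x y ≤ r := by
  obtain ⟨y, hy, hxy⟩ := hBc.exists_infDist_eq_dist hB x
  refine ⟨y, hy, hxy.symm, hxy ▸ le_trans ?_ h⟩
  exact infDist_le_hausdorffDist_of_mem hx
    (hausdorffEDist_ne_top_of_nonempty_of_bounded hA hB hAc.isBounded hBc.isBounded)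

/-- The two points of a metric pair are at distance at most `hausdorffDist A B`. -/
theorem dist_le_hausdorffDist_of_mem_metricPairs {d : ℕ} {A B : Set (EuclideanSpace ℝ (Fin d))}
    (hAc : IsCompact A) (hBc : IsCompact B)
    {p : EuclideanSpace ℝ (Fin d) × EuclideanSpace ℝ (Fin d)} (hp : p ∈ metricPairs d A B) :
    dist p.1 p.2 ≤ hausdorffDist A B := by
  obtain ⟨ha, hb, h⟩ := hp
  have htop := hausdorffEDist_ne_top_of_nonempty_of_bounded ⟨_, ha⟩ ⟨_, hb⟩
    hAc.isBounded hBc.isBounded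
  rw [dist_eq_norm]
  rcases h with h | h
  · exact h ▸ infDist_le_hausdorffDist_of_mem ha htop
  · rw [h, hausdorffDist_comm]
    exact infDist_le_hausdorffDist_of_mem hb (by rwa [hausdorffEDist_comm])

theorem dist_convexComb_left_le {E : Type*} [NormedAddCommGroup E] [NormedSpace ℝ E] (a b : E)
    {w : ℝ} (hw₀ : 0 ≤ w) (hw₁ : w ≤ 1) :
    dist a ((1 - w) • a + w • b) ≤ dist a b := by
  have h : a - ((1 - w) • a + w • b) = w • (a - b) := by module
  rw [dist_eq_norm, dist_eq_norm, h, norm_smul, Real.norm_of_nonneg hw₀]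
  exact mul_le_of_le_one_left (norm_nonneg _) hw₁

/-- The metric average with weight in `[0,1]` stays within `hausdorffDist A B` of `A`. -/
theorem exists_dist_le_metricAverage {d : ℕ} {A B : Set (EuclideanSpace ℝ (Fin d))}
    (hA : A.Nonempty) (hAc : IsCompact A) (hB : B.Nonempty) (hBc : IsCompact B)
    {w : ℝ} (hw₀ : 0 ≤ w) (hw₁ : w ≤ 1) :
    (∀ x ∈ A, ∃ y ∈ metricAverage d A B w, dist x y ≤ hausdorffDist A B) ∧
      ∀ y ∈ metricAverage d A B w, ∃ x ∈ A, dist y x ≤ hausdorffDist A B := by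
  constructor
  · intro a ha
    obtain ⟨b, hb, hab, hle⟩ := exists_dist_eq_infDist_le hA hAc hB hBc le_rfl ha
    exact ⟨_, ⟨(a, b), ⟨ha, hb, Or.inl (by rw [← dist_eq_norm]; exact hab)⟩, rfl⟩,
      (dist_convexComb_left_le a b hw₀ hw₁).trans hle⟩
  · rintro _ ⟨⟨a, b⟩, hp, rfl⟩
    refine ⟨a, hp.1, ?_⟩
    rw [dist_comm]
    exact (dist_convexComb_left_le a b hw₀ hw₁).trans
      (dist_le_hausdorffDist_of_mem_metricPairs (p := (a, b)) hAc hBc hp)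

/-- A bound on the images that is uniform over `[0,1]` bounds the distance of the graphs. -/
theorem hausdorffDist_svGraph_le {d : ℕ} {F G : ℝ → Set (EuclideanSpace ℝ (Fin d))} {r : ℝ}
    (hr : 0 ≤ r)
    (h : ∀ t ∈ Icc (0 : ℝ) 1, (∀ x ∈ F t, ∃ y ∈ G t, dist x y ≤ r) ∧
      ∀ y ∈ G t, ∃ x ∈ F t, dist y x ≤ r) :
    hausdorffDist (svGraph d F) (svGraph d G) ≤ r := by
  have hdist (t : ℝ) (x y : EuclideanSpace ℝ (Fin d)) :
      dist (WithLp.toLp 2 (t, x)) (WithLp.toLp 2 (t, y)) = dist x y := by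
    rw [WithLp.prod_dist_eq_of_L2]
    simp
  refine hausdorffDist_le_of_mem_dist hr ?_ ?_
  · rintro ⟨t, x⟩ ⟨ht, hx⟩
    obtain ⟨y, hy, hxy⟩ := (h t ht).1 x hx
    exact ⟨WithLp.toLp 2 (t, y), ⟨ht, hy⟩, (hdist t x y).trans_le hxy⟩
  · rintro ⟨t, y⟩ ⟨ht, hy⟩
    obtain ⟨x, hx, hyx⟩ := (h t ht).2 y hy
    exact ⟨WithLp.toLp 2 (t, x), ⟨ht, hx⟩, (hdist t y x).trans_le hyx⟩

theorem metricAverage_piecewise_interpolation_graph_error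
    (d : ℕ) (F : ℝ → Set (EuclideanSpace ℝ (Fin d)))
    (C₁ : Set (EuclideanSpace ℝ (Fin d))) (hC₁ : Bornology.IsBounded C₁)
    (hFne : ∀ t ∈ Icc (0 : ℝ) 1, (F t).Nonempty ∧ IsCompact (F t) ∧ F t ⊆ C₁)
    (L : ℝ)
    (hLip : ∀ t₁ ∈ Icc (0 : ℝ) 1, ∀ t₂ ∈ Icc (0 : ℝ) 1,
      hausdorffDist (F t₁) (F t₂) ≤ L * |t₁ - t₂|)
    (δ : ℝ) (hδ : 0 < δ) (J : ℕ) (hJδ : (J : ℝ) * δ = 1)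
    (A : ℕ → Set (EuclideanSpace ℝ (Fin d)))
    (C₂ : Set (EuclideanSpace ℝ (Fin d))) (hC₂ : Bornology.IsBounded C₂)
    (hAne : ∀ j ≤ J, (A j).Nonempty ∧ IsCompact (A j) ∧ A j ⊆ C₂)
    (ε : ℝ)
    (hAF : ∀ j ≤ J, hausdorffDist (A j) (F ((j : ℝ) * δ)) ≤ ε)
    (Ftil : ℝ → Set (EuclideanSpace ℝ (Fin d)))
    (hFtilNode : ∀ j ≤ J, Ftil ((j : ℝ) * δ) = A j)
    (hFtilMid : ∀ j < J, ∀ t ∈ Ioo ((j : ℝ) * δ) (((j : ℝ) + 1) * δ),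
      Ftil t = metricAverage d (A j) (A (j + 1)) ((t - (j : ℝ) * δ) / δ)) :
    hausdorffDist (svGraph d Ftil) (svGraph d F) ≤ 3 * ε + 2 * L * δ := by
  have hL : 0 ≤ L := by
    have h := hausdorffDist_nonneg.trans (hLip 0 (by simp) 1 (by simp))
    simpa using h
  have hε : 0 ≤ ε := hausdorffDist_nonneg.trans (hAF 0 (Nat.zero_le J))
  have hLδ : 0 ≤ L * δ := mul_nonneg hL hδ.le
  have hnode (j : ℕ) (hj : j ≤ J) : (j : ℝ) * δ ∈ Icc (0 : ℝ) 1 :=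
    ⟨by positivity, hJδ ▸ mul_le_mul_of_nonneg_right (by exact_mod_cast hj) hδ.le⟩
  refine hausdorffDist_svGraph_le (by linarith) fun t ht => ?_
  obtain ⟨j, hjt, htj⟩ : ∃ j : ℕ, (j : ℝ) * δ ≤ t ∧ t < ((j : ℝ) + 1) * δ :=
    ⟨⌊t / δ⌋₊, (le_div_iff₀ hδ).1 (Nat.floor_le (div_nonneg ht.1 hδ.le)),
      (div_lt_iff₀ hδ).1 (Nat.lt_floor_add_one _)⟩
  have hjJ : j ≤ J := by
    have h : (j : ℝ) * δ ≤ J * δ := by linarith [ht.2]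
    exact_mod_cast le_of_mul_le_mul_right h hδ
  obtain ⟨hAj, hAjc, -⟩ := hAne j hjJ
  obtain ⟨hFj, hFjc, -⟩ := hFne _ (hnode j hjJ)
  obtain ⟨hFt, hFtc, -⟩ := hFne t ht
  rcases hjt.eq_or_lt with rfl | hlt
  · rw [hFtilNode j hjJ]
    constructor
    · intro x hx
      obtain ⟨y, hy, -, hxy⟩ :=
        exists_dist_eq_infDist_le hAj hAjc hFj hFjc (hAF j hjJ) hx
      exact ⟨y, hy, by linarith⟩
    · intro y hy
      obtain ⟨x, hx, -, hyx⟩ := exists_dist_eq_infDist_le hFj hFjc hAj hAjc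
        (hausdorffDist_comm.trans_le (hAF j hjJ)) hy
      exact ⟨x, hx, by linarith⟩
  have hjJ' : j < J := by
    have h : (j : ℝ) * δ < J * δ := by linarith [ht.2]
    exact_mod_cast lt_of_mul_lt_mul_right h hδ.le
  obtain ⟨hAs, hAsc, -⟩ := hAne (j + 1) hjJ'
  obtain ⟨hFs, hFsc, -⟩ := hFne _ (hnode (j + 1) hjJ')
  have hFjt : hausdorffDist (F ((j : ℝ) * δ)) (F t) ≤ L * δ := by
    refine (hLip _ (hnode j hjJ) t ht).trans (mul_le_mul_of_nonneg_left ?_ hL)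
    rw [abs_le]
    constructor <;> linarith
  have hAjs : hausdorffDist (A j) (A (j + 1)) ≤ 2 * ε + L * δ := by
    have hFjs : hausdorffDist (F ((j : ℝ) * δ)) (F (((j + 1 : ℕ) : ℝ) * δ)) ≤ L * δ := by
      refine (hLip _ (hnode j hjJ) _ (hnode (j + 1) hjJ')).trans
        (mul_le_mul_of_nonneg_left ?_ hL)
      rw [abs_le]
      push_cast
      constructor <;> linarith
    have h₁ := hausdorffDist_triangle (u := A (j + 1))
      (hausdorffEDist_ne_top_of_nonempty_of_bounded hAj hFj hAjc.isBounded hFjc.isBounded)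
    have h₂ := hausdorffDist_triangle (u := A (j + 1))
      (hausdorffEDist_ne_top_of_nonempty_of_bounded hFj hFs hFjc.isBounded hFsc.isBounded)
    have h₃ := hausdorffDist_comm.trans_le (hAF (j + 1) hjJ')
    linarith [hAF j hjJ]
  have hw₀ : 0 ≤ (t - (j : ℝ) * δ) / δ := div_nonneg (by linarith) hδ.le
  have hw₁ : (t - (j : ℝ) * δ) / δ ≤ 1 := (div_le_one hδ).2 (by linarith)
  obtain ⟨hto, hfrom⟩ := exists_dist_le_metricAverage hAj hAjc hAs hAsc hw₀ hw₁
  rw [hFtilMid j hjJ' t ⟨hlt, htj⟩]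
  constructor
  · intro p hp
    obtain ⟨a, ha, hpa⟩ := hfrom p hp
    obtain ⟨x, hx, -, hax⟩ :=
      exists_dist_eq_infDist_le hAj hAjc hFj hFjc (hAF j hjJ) ha
    obtain ⟨y, hy, -, hxy⟩ := exists_dist_eq_infDist_le hFj hFjc hFt hFtc hFjt hx
    exact ⟨y, hy, by linarith [dist_triangle4 p a x y]⟩
  · intro y hy
    obtain ⟨x, hx, -, hyx⟩ := exists_dist_eq_infDist_le hFt hFtc hFj hFjc
      (hausdorffDist_comm.trans_le hFjt) hy
    obtain ⟨a, ha, -, hxa⟩ := exists_dist_eq_infDist_le hFj hFjc hAj hAjc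
      (hausdorffDist_comm.trans_le (hAF j hjJ)) hx
    obtain ⟨p, hp, hap⟩ := hto a ha
    exact ⟨p, hp, by linarith [dist_triangle4 y x a p]⟩
end
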